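/- Let A_1, …, A_{k+1} be closed subsets of the standard k-simplex Δ_k such that for every nonempty S ⊆ [k+1] the face Δ^S is contained in ⋃_{i ∈ S} A_i. Then ⋂_{i ∈ [k+1]} A_i ≠ ∅. -/

import Mathlib

/-- A finite set `σ` is dominant for the orders induced by `v i` if every `y` lies below all of `σ`
in at least one of the orders. -/
def IsDominant {T I : Type*} (v : I → T → ℕ) (σ : Finset T) : Prop :=
  ∀ y, ∃ i, ∀ x ∈ σ, v i y ≤ v i x

namespace IsDominant

open Finset

variable {T I : Type*} {v : I → T → ℕ}

theorem mono {σ τ : Finset T} (h : IsDominant v τ) (hst : σ ⊆ τ) : IsDominant v σ := fun y => by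
  obtain ⟨i, hi⟩ := h y
  exact ⟨i, fun x hx => hi x (hst hx)⟩

variable [Fintype T] [DecidableEq T] [Fintype I] [DecidableEq I]

/-- A nonempty dominant set with one element less than there are orders extends in exactly two ways
to a dominant set with one more element, provided that for each `i` some `z` exceeds its minimum in
all the orders other than the `i`-th. -/
theorem exists_pair_insert (hv : ∀ i, Function.Injective (v i)) {σ : Finset T}
    (hσ : IsDominant v σ) (hcard : #σ + 1 = Fintype.card I) (hne : σ.Nonempty)
    (hside : ∀ i, ∃ z, ∀ k ≠ i, ∃ x ∈ σ, v k x < v k z) :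
    ∃ y₁ y₂, y₁ ≠ y₂ ∧ ∀ y, (y ∉ σ ∧ IsDominant v (insert y σ)) ↔ y = y₁ ∨ y = y₂ := by
  classical
  choose m hmσ hm using fun i => exists_min_image σ (v i) hne
  have hsurj : ∀ x ∈ σ, ∃ i, m i = x := fun x hx => by
    obtain ⟨i, hi⟩ := hσ x
    exact ⟨i, hv i (le_antisymm (hm i x hx) (hi _ (hmσ i)))⟩
  obtain ⟨i, -, j, -, hij, hmij⟩ : ∃ i ∈ (univ : Finset I), ∃ j ∈ (univ : Finset I),
      i ≠ j ∧ m i = m j :=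
    exists_ne_map_eq_of_card_lt_of_maps_to (by rw [card_univ]; omega) (fun i _ => hmσ i)
  let S : I → Finset T := fun i => univ.filter fun z => ∀ k ≠ i, v k (m k) < v k z
  have hS : ∀ i z, z ∈ S i ↔ ∀ k ≠ i, v k (m k) < v k z := fun i z => by simp [S]
  have hSne : ∀ i, (S i).Nonempty := fun i => by
    obtain ⟨z, hz⟩ := hside i
    refine ⟨z, (hS i z).2 fun k hk => ?_⟩
    obtain ⟨x, hx, hxz⟩ := hz k hk
    exact (hm k x hx).trans_lt hxz
  choose t htS ht using fun i => exists_max_image (S i) (v i) (hSne i)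
  have hback : ∀ i j, i ≠ j → m i = m j → t i ∉ σ ∧ IsDominant v (insert (t i) σ) := by
    intro i j hij hmij
    have hti := (hS i (t i)).1 (htS i)
    refine ⟨fun hmem => ?_, fun z => ?_⟩
    · obtain ⟨k, hk⟩ := hsurj _ hmem
      by_cases hki : k = i
      · subst hki
        have := hti j hij.symm
        rw [← hmij, hk] at this
        exact this.false
      · have := hti k hki
        rw [hk] at this
        exact this.false
    · by_cases hz : z ∈ S i
      · refine ⟨i, fun x hx => ?_⟩
        rcases mem_insert.1 hx with rfl | hx
        · exact ht i z hz
        · obtain ⟨k, hk⟩ := hσ z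
          by_cases hki : k = i
          · exact hki ▸ hk x hx
          · exact absurd ((hS i z).1 hz k hki) (hk _ (hmσ k)).not_gt
      · rw [hS] at hz
        push Not at hz
        obtain ⟨k, hki, hk⟩ := hz
        refine ⟨k, fun x hx => ?_⟩
        rcases mem_insert.1 hx with rfl | hx
        · exact hk.trans (hti k hki).le
        · exact hk.trans (hm k x hx)
  refine ⟨t i, t j, fun h => ?_, fun y => ⟨?_, ?_⟩⟩
  · obtain ⟨k, hk⟩ := hσ (t i)
    have hk := hk _ (hmσ k)
    by_cases hki : k = i
    · have := (hS j (t j)).1 (htS j) k (hki ▸ hij)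
      rw [← h] at this
      omega
    · have := (hS i (t i)).1 (htS i) k hki
      omega
  · rintro ⟨hyσ, hy⟩
    obtain ⟨k₀, hk₀⟩ := hy y
    let K : Finset I := univ.filter fun k => v k (m k) < v k y
    have hk₀K : k₀ ∉ K := by simpa [K] using hk₀ _ (mem_insert_of_mem (hmσ k₀))
    have hKσ : σ ⊆ K.image m := fun x hx => by
      obtain ⟨k, hk⟩ := hy x
      have hkx : m k = x := hv k (le_antisymm (hm k x hx) (hk _ (mem_insert_of_mem (hmσ k))))
      refine mem_image.2 ⟨k, ?_, hkx⟩
      have h1 := hk y (mem_insert_self _ _)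
      have h2 : v k x ≠ v k y := fun h => hyσ (hv k h ▸ hx)
      simp only [K, mem_filter, mem_univ, true_and, hkx]
      omega
    have hKle : K ⊆ univ.erase k₀ := fun k hk =>
      mem_erase.2 ⟨fun h => hk₀K (h ▸ hk), mem_univ _⟩
    have h1 := card_le_card hKσ
    have h2 := card_image_le (s := K) (f := m)
    have h3 : #(univ.erase k₀) + 1 = Fintype.card I := card_erase_add_one (mem_univ k₀)
    have hKeq : K = univ.erase k₀ := eq_of_subset_of_card_le hKle (by omega)
    have hinj : Set.InjOn m K := card_image_iff.1 (by rw [← hKeq] at h3; omega)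
    have hyS : y ∈ S k₀ := (hS _ _).2 fun k hk => by
      have : k ∈ K := hKeq ▸ mem_erase.2 ⟨hk, mem_univ _⟩
      simpa [K] using this
    have hyt : y = t k₀ := by
      refine hv k₀ (le_antisymm (ht k₀ y hyS) ?_)
      obtain ⟨k, hk⟩ := hy (t k₀)
      by_cases hkk : k = k₀
      · exact hkk ▸ hk y (mem_insert_self _ _)
      · have := (hS _ _).1 (htS k₀) k hkk
        exact absurd (hk _ (mem_insert_of_mem (hmσ k))) this.not_ge
    by_cases hi : k₀ = i
    · exact Or.inl (hi ▸ hyt)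
    by_cases hj : k₀ = j
    · exact Or.inr (hj ▸ hyt)
    have hiK : i ∈ (K : Set I) := by rw [hKeq]; simpa using Ne.symm hi
    have hjK : j ∈ (K : Set I) := by rw [hKeq]; simpa using Ne.symm hj
    exact absurd (hinj hiK hjK hmij) hij
  · rintro (rfl | rfl)
    · exact hback i j hij hmij
    · exact hback j i hij.symm hmij.symm

/-- The boundary case: the set of all dummies `d i` with `i ≠ l` extends in exactly one way. -/
theorem existsUnique_insert_dummies (hv : ∀ i, Function.Injective (v i)) {d : I → T}
    (hd : Function.Injective d)
    (hmin : ∀ i x, x ≠ d i → v i (d i) < v i x)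
    (hmax : ∀ i j x, i ≠ j → x ∉ Set.range d → v i x < v i (d j)) (l : I) :
    ∃ y₁, ∀ y, (y ∉ (univ.erase l).image d ∧
      IsDominant v (insert y ((univ.erase l).image d))) ↔ y = y₁ := by
  classical
  set σ := (univ.erase l).image d with hσ
  have hdσ : ∀ k, k ≠ l → d k ∈ σ := fun k hk => mem_image_of_mem _ (by simpa using hk)
  have hl : d l ∈ σᶜ := by simp [hσ, hd.eq_iff]
  obtain ⟨t, htσ, ht⟩ := exists_max_image σᶜ (v l) ⟨_, hl⟩
  refine ⟨t, fun y => ⟨?_, ?_⟩⟩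
  · rintro ⟨hyσ, hy⟩
    refine hv l (le_antisymm (ht y (mem_compl.2 hyσ)) ?_)
    obtain ⟨k, hk⟩ := hy t
    by_cases hkl : k = l
    · exact hkl ▸ hk y (mem_insert_self _ _)
    · have h1 := hk _ (mem_insert_of_mem (hdσ k hkl))
      have h2 := hmin k t fun h => mem_compl.1 htσ (h ▸ hdσ k hkl)
      omega
  · rintro rfl
    refine ⟨mem_compl.1 htσ, fun z => ?_⟩
    by_cases hz : z ∈ σ
    · obtain ⟨k, -, rfl⟩ := mem_image.1 hz
      refine ⟨k, fun x _ => ?_⟩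
      rcases eq_or_ne x (d k) with rfl | hx
      · exact le_rfl
      · exact (hmin k x hx).le
    · refine ⟨l, fun x hx => ?_⟩
      rcases mem_insert.1 hx with rfl | hx
      · exact ht z (mem_compl.2 hz)
      obtain ⟨k, hk, rfl⟩ := mem_image.1 hx
      have hkl : l ≠ k := (ne_of_mem_erase hk).symm
      by_cases hzd : z ∈ Set.range d
      · obtain ⟨i, rfl⟩ := hzd
        have hil : i = l := by_contra fun h => hz (hdσ i h)
        subst hil
        exact (hmin i _ fun h => hkl (hd h).symm).le
      · exact (hmax l k z hkl hzd).le

/-- **Scarf's lemma**: in a coloring in which each dummy `d i` has color `i`, some dominant set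
carries all the colors. -/
theorem exists_colorful (hv : ∀ i, Function.Injective (v i)) {d : I → T} {c : T → I}
    (hmin : ∀ i x, x ≠ d i → v i (d i) < v i x)
    (hmax : ∀ i j x, i ≠ j → x ∉ Set.range d → v i x < v i (d j))
    (hc : ∀ i, c (d i) = i) [Nonempty I] :
    ∃ ρ : Finset T, IsDominant v ρ ∧ ρ.image c = univ := by
  classical
  by_contra! hno
  have hd : Function.Injective d := Function.LeftInverse.injective hc
  obtain ⟨l⟩ := ‹Nonempty I›
  let P : Finset (Finset T × T) := univ.filter fun p =>
    p.2 ∉ p.1 ∧ IsDominant v (insert p.2 p.1) ∧ #p.1 + 1 = Fintype.card I ∧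
      p.1.image c = univ.erase l
  have hP : ∀ σ y, (σ, y) ∈ P ↔ y ∉ σ ∧ IsDominant v (insert y σ) ∧ #σ + 1 = Fintype.card I ∧
      σ.image c = univ.erase l := fun σ y => by simp [P]
  have heven : Even #P := by
    rw [card_eq_sum_card_image (fun p => insert p.2 p.1) P]
    refine even_sum _ fun ρ hρ => ?_
    obtain ⟨⟨σ, y⟩, hp, rfl⟩ := mem_image.1 hρ
    obtain ⟨hyσ, hdom, hcard, him⟩ := (hP _ _).1 hp
    have hl : #(univ.erase l) + 1 = Fintype.card I := card_erase_add_one (mem_univ l)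
    have hinj : Set.InjOn c σ := card_image_iff.1 (by rw [him]; omega)
    have hcy : c y ≠ l := fun h => hno _ hdom (by
      rw [image_insert, him, h, insert_erase (mem_univ l)])
    obtain ⟨x, hxσ, hxy⟩ : ∃ x ∈ σ, c x = c y :=
      mem_image.1 (him ▸ mem_erase.2 ⟨hcy, mem_univ _⟩)
    have hxy' : x ≠ y := fun h => hyσ (h ▸ hxσ)
    have : #{p ∈ P | insert p.2 p.1 = insert y σ} = 2 := by
      refine card_eq_two.2 ⟨(σ, y), (insert y (σ.erase x), x),
        fun h => hxy' (Prod.ext_iff.1 h).2.symm, ?_⟩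
      have hins : insert x (insert y (σ.erase x)) = insert y σ := by
        rw [insert_comm, insert_erase hxσ]
      have himx : (insert y (σ.erase x)).image c = univ.erase l := by
        rw [image_insert, ← hxy, ← image_insert, insert_erase hxσ, him]
      ext ⟨τ, z⟩
      simp only [mem_filter, mem_insert, mem_singleton, Prod.mk.injEq]
      constructor
      · rintro ⟨hz, hins'⟩
        obtain ⟨hzτ, -, -, himτ⟩ := (hP _ _).1 hz
        have hτ : τ = (insert y σ).erase z := by rw [← hins', erase_insert hzτ]
        have hzmem : z ∈ insert y σ := hins' ▸ mem_insert_self _ _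
        rcases mem_insert.1 hzmem with rfl | hzσ
        · exact Or.inl ⟨by rw [hτ, erase_insert hyσ], rfl⟩
        have hzy : z ≠ y := fun h => hyσ (h ▸ hzσ)
        have hczl : c z ∈ univ.erase l := him ▸ mem_image_of_mem c hzσ
        obtain ⟨w, hw, hwz⟩ := mem_image.1 (himτ ▸ hczl)
        rw [hτ, mem_erase, mem_insert] at hw
        rcases hw with ⟨hwz', rfl | hwσ⟩
        · have hzx : z = x := hinj hzσ hxσ (hwz.symm.trans hxy.symm)
          subst hzx
          exact Or.inr ⟨by rw [hτ, erase_insert_of_ne hzy.symm], rfl⟩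
        · exact absurd (hinj hwσ hzσ hwz) hwz'
      · rintro (⟨rfl, rfl⟩ | ⟨rfl, rfl⟩)
        · exact ⟨hp, rfl⟩
        · refine ⟨(hP _ _).2 ⟨by simp [hxy'], hins ▸ hdom, ?_, himx⟩, hins⟩
          rw [card_insert_of_notMem (by simp [hyσ]), card_erase_add_one hxσ, hcard]
    rw [this]
    exact even_two
  have hfiber : ∀ σ y, (σ, y) ∈ P → ∀ z, (σ, z) ∈ P ↔ (z ∉ σ ∧ IsDominant v (insert z σ)) := by
    intro σ y h z
    have := (hP _ _).1 h
    rw [hP]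
    tauto
  obtain ⟨y₁, hy₁⟩ := existsUnique_insert_dummies hv hd hmin hmax l
  set σ₀ := (univ.erase l).image d with hσ₀
  have hmem₀ : ∀ z, (σ₀, z) ∈ P ↔ z = y₁ := fun z => by
    have h1 : #σ₀ + 1 = Fintype.card I := by
      rw [card_image_of_injective _ hd]
      exact card_erase_add_one (mem_univ l)
    have h2 : σ₀.image c = univ.erase l := by
      rw [hσ₀, image_image, show c ∘ d = id from funext hc, image_id]
    rw [hP, ← hy₁]
    tauto
  have hodd : Odd #P := by
    rw [card_eq_sum_card_image Prod.fst P,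
      ← add_sum_erase _ _ (mem_image.2 ⟨(σ₀, y₁), (hmem₀ _).2 rfl, rfl⟩)]
    refine Odd.add_even ?_ (even_sum _ fun σ hσ => ?_)
    · have : {p ∈ P | p.1 = σ₀} = {(σ₀, y₁)} := by
        ext ⟨τ, z⟩
        simp only [mem_filter, mem_singleton, Prod.mk.injEq]
        constructor
        · rintro ⟨h, rfl⟩
          exact ⟨rfl, (hmem₀ _).1 h⟩
        · rintro ⟨rfl, rfl⟩
          exact ⟨(hmem₀ _).2 rfl, rfl⟩
      rw [this, card_singleton]
      exact odd_one
    · obtain ⟨hne, hσ⟩ := mem_erase.1 hσ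
      obtain ⟨⟨σ, y⟩, hp, rfl⟩ := mem_image.1 hσ
      obtain ⟨hyσ, hdom, hcard, him⟩ := (hP _ _).1 hp
      obtain ⟨x₀, hx₀σ, hx₀⟩ : ∃ x ∈ σ, x ∉ Set.range d := by
        by_contra! hall
        refine hne ?_
        have hx : ∀ x ∈ σ, d (c x) = x := fun x hx => by
          obtain ⟨i, rfl⟩ := hall x hx
          rw [hc]
        change σ = _
        rw [hσ₀, ← him, image_image]
        exact ((image_congr hx).trans image_id).symm
      obtain ⟨z₁, z₂, hz, hiff⟩ := exists_pair_insert hv (hdom.mono (subset_insert _ _)) hcard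
        ⟨x₀, hx₀σ⟩ fun i => ⟨d i, fun k hk => ⟨x₀, hx₀σ, hmax k i x₀ hk hx₀⟩⟩
      have : {p ∈ P | p.1 = σ} = {(σ, z₁), (σ, z₂)} := by
        ext ⟨τ, z⟩
        simp only [mem_filter, mem_insert, mem_singleton, Prod.mk.injEq, ← and_or_left]
        constructor
        · rintro ⟨h, rfl⟩
          exact ⟨rfl, (hiff z).1 ((hfiber _ _ hp z).1 h)⟩
        · rintro ⟨rfl, h⟩
          exact ⟨(hfiber _ _ hp z).2 ((hiff z).2 h), rfl⟩
      rw [this, card_pair (by simpa using hz)]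
      exact even_two
  exact (Nat.not_even_iff_odd.2 hodd) heven

/-- Scarf's lemma for weights that may have ties. -/
theorem exists_colorful_of_weight {w : I → T → ℕ} {d : I → T} {c : T → I}
    (hmin : ∀ i x, x ≠ d i → w i (d i) < w i x)
    (hmax : ∀ i j x, i ≠ j → x ∉ Set.range d → w i x < w i (d j))
    (hc : ∀ i, c (d i) = i) [Nonempty I] :
    ∃ ρ : Finset T, IsDominant w ρ ∧ ρ.image c = univ := by
  let e := Fintype.equivFin T
  let u : I → T → ℕ := fun i x => Fintype.card T * w i x + e x
  have hlt : ∀ i x y, w i x < w i y → u i x < u i y := fun i x y h => by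
    have h1 := (e x).isLt
    have h2 : Fintype.card T * (w i x + 1) ≤ Fintype.card T * w i y := Nat.mul_le_mul_left _ h
    simp only [u]
    linarith [Nat.zero_le (e y : ℕ)]
  have hinj : ∀ i, Function.Injective (u i) := fun i x y h => by
    rcases lt_trichotomy (w i x) (w i y) with h' | h' | h'
    · exact absurd h (hlt i x y h').ne
    · simp only [u, h', add_right_inj] at h
      exact e.injective (Fin.ext h)
    · exact absurd h (hlt i y x h').ne'
  obtain ⟨ρ, hρ, hρc⟩ := exists_colorful (v := u) hinj (fun i x hx => hlt _ _ _ (hmin i x hx))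
    (fun i j x hij hx => hlt _ _ _ (hmax i j x hij hx)) hc
  refine ⟨ρ, fun y => ?_, hρc⟩
  obtain ⟨i, hi⟩ := hρ y
  exact ⟨i, fun x hx => le_of_not_gt fun h => (hi x hx).not_gt (hlt _ _ _ h)⟩

end IsDominant

/-- A combinatorial covering lemma on the grid `{a : Σ a = N}`: any coloring of the grid admits a
grid point `a` such that, for each color `i`, either `a i` is small or a point of color `i` is near
`a`. -/
theorem exists_near_colors {I : Type*} [Fintype I] [DecidableEq I] [Nonempty I] (N : ℕ)
    (c : (I → ℕ) → I) :
    ∃ a : I → ℕ, ∑ j, a j = N ∧ ∀ i, a i ≤ Fintype.card I ∨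
      ∃ b : I → ℕ, ∑ j, b j = N ∧ c b = i ∧
        ∀ j, a j ≤ b j + Fintype.card I ∧ b j ≤ a j + Fintype.card I := by
  classical
  let G := (Finset.univ : Finset I).piAntidiag N
  have hG : ∀ a, a ∈ G ↔ ∑ j, a j = N := fun a => by simp [G]
  let w : I → G ⊕ I → ℕ := fun i =>
    Sum.elim (fun a => a.1 i + 1) (fun j => if j = i then 0 else N + 2)
  have hle : ∀ (a : G) i, a.1 i ≤ N := fun a i =>
    ((hG _).1 a.2) ▸ Finset.single_le_sum (f := a.1) (fun _ _ => Nat.zero_le _) (Finset.mem_univ i)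
  obtain ⟨ρ, hρ, hρc⟩ := IsDominant.exists_colorful_of_weight (w := w) (d := Sum.inr)
    (c := Sum.elim (fun a => c a.1) id)
    (by
      rintro i (a | j) hx
      · simp [w]
      · have : j ≠ i := fun h => hx (h ▸ rfl)
        simp [w, this])
    (by
      rintro i j (a | l) hij hx
      · have := hle a i
        simp only [w, Sum.elim_inl, Sum.elim_inr, if_neg hij.symm]
        omega
      · exact absurd ⟨l, rfl⟩ hx)
    (fun i => rfl)
  have hcol : ∀ i, ∃ x ∈ ρ, Sum.elim (fun a : G => c a.1) id x = i := fun i =>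
    Finset.mem_image.1 (hρc ▸ Finset.mem_univ i)
  have hne : ρ.Nonempty := (hcol (Classical.arbitrary I)).imp fun _ h => h.1
  choose m hmρ hm using fun i => Finset.exists_min_image ρ (w i) hne
  let M : I → ℕ := fun i => w i (m i)
  have hM : N < ∑ i, M i := by
    by_contra! h
    let i₀ := Classical.arbitrary I
    let y : I → ℕ := M + Pi.single i₀ (N - ∑ i, M i)
    have hy : y ∈ G := (hG _).2 (by
      simp only [y, Pi.add_apply, Finset.sum_add_distrib, Finset.sum_pi_single', Finset.mem_univ,
        if_true]
      omega)
    obtain ⟨i, hi⟩ := hρ (Sum.inl ⟨y, hy⟩)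
    have h1 : M i + Pi.single (M := fun _ => ℕ) i₀ (N - ∑ i, M i) i + 1 ≤ M i := hi _ (hmρ i)
    omega
  have hlow : ∀ a : G, Sum.inl a ∈ ρ → ∀ i, M i ≤ a.1 i + 1 := fun a ha i => hm i _ ha
  have hup : ∀ a : G, Sum.inl a ∈ ρ → ∀ i, a.1 i + 1 ≤ M i + Fintype.card I := by
    intro a ha i
    have h1 : ∑ j, (a.1 j + 1) = N + Fintype.card I := by
      rw [Finset.sum_add_distrib, (hG _).1 a.2]
      simp
    rw [← Finset.add_sum_erase _ _ (Finset.mem_univ i)] at h1 hM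
    have h2 := Finset.sum_le_sum (s := Finset.univ.erase i) fun j _ => hlow a ha j
    omega
  have hdummy : ∀ i, Sum.inr i ∈ ρ → M i = 0 := fun i hi => by
    have : M i ≤ w i (Sum.inr i) := hm i _ hi
    simpa [w] using this
  obtain ⟨a, ha⟩ : ∃ a : G, Sum.inl a ∈ ρ := by
    by_contra! h
    have : ∀ i, M i = 0 := fun i => by
      obtain ⟨a | j, hx, hxi⟩ := hcol i
      · exact absurd hx (h a)
      · exact hdummy i (by rwa [show j = i from hxi] at hx)
    simp [this] at hM
  refine ⟨a.1, (hG _).1 a.2, fun i => ?_⟩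
  obtain ⟨b | j, hx, hxi⟩ := hcol i
  · refine Or.inr ⟨b.1, (hG _).1 b.2, hxi, fun j => ?_⟩
    have := hlow a ha j
    have := hlow b hx j
    have := hup a ha j
    have := hup b hx j
    omega
  · left
    have := hup a ha i
    have := hdummy i (by rwa [show j = i from hxi] at hx)
    omega

/-- The dual KKM theorem: closed sets covering the simplex, the `i`-th of which contains the facet
`x i = 0`, have a common point. -/
theorem exists_mem_of_facet_subset {I : Type*} [Fintype I] [Nonempty I] (B : I → Set (I → ℝ))
    (hclosed : ∀ i, IsClosed (B i)) (hcover : ∀ x ∈ stdSimplex ℝ I, ∃ i, x ∈ B i)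
    (hfacet : ∀ i, ∀ x ∈ stdSimplex ℝ I, x i = 0 → x ∈ B i) :
    ∃ x ∈ stdSimplex ℝ I, ∀ i, x ∈ B i := by
  classical
  rcases subsingleton_or_nontrivial I with hI | hI
  · obtain ⟨i₀⟩ := ‹Nonempty I›
    have hx := single_mem_stdSimplex ℝ i₀
    obtain ⟨j, hj⟩ := hcover _ hx
    exact ⟨_, hx, fun i => Subsingleton.elim j i ▸ hj⟩
  have hBne : ∀ i, (B i).Nonempty := fun i => by
    obtain ⟨j, hj⟩ := exists_ne i
    exact ⟨_, hfacet i _ (single_mem_stdSimplex ℝ j) (Pi.single_eq_of_ne hj.symm _)⟩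
  let F : (I → ℝ) → ℝ := fun x => ∑ i, Metric.infDist x (B i)
  have hF : Continuous F := continuous_finsetSum _ fun i _ => Metric.continuous_infDist_pt _
  obtain ⟨p, hp, hpmin⟩ := (isCompact_stdSimplex (𝕜 := ℝ) (ι := I)).exists_isMinOn
    ⟨_, single_mem_stdSimplex ℝ (Classical.arbitrary I)⟩ hF.continuousOn
  have hpmin : ∀ x ∈ stdSimplex ℝ I, F p ≤ F x := fun x hx => hpmin hx
  choose! c hc using hcover
  set n := Fintype.card I
  have hbound : ∀ N : ℕ, F p ≤ ((n : ℝ) * n) / (N + 1 : ℕ) := by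
    intro N
    have hN : (0 : ℝ) < (N + 1 : ℕ) := by positivity
    let r : (I → ℕ) → I → ℝ := fun a i => a i / (N + 1 : ℕ)
    have hr : ∀ a : I → ℕ, ∑ j, a j = N + 1 → r a ∈ stdSimplex ℝ I := fun a ha => by
      refine ⟨fun i => by positivity, ?_⟩
      simp only [r]
      rw [← Finset.sum_div, ← Nat.cast_sum, ha, div_self hN.ne']
    obtain ⟨a, ha, hac⟩ := exists_near_colors (N + 1) fun a => c (r a)
    refine (hpmin _ (hr a ha)).trans ?_
    have hdist : ∀ i, Metric.infDist (r a) (B i) ≤ (n : ℝ) / (N + 1 : ℕ) := by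
      intro i
      rcases hac i with hi | ⟨b, hb, hbi, hab⟩
      · obtain ⟨j, hj⟩ := exists_ne i
        let b : I → ℕ := fun l => if l = i then 0 else if l = j then a j + a i else a l
        have hb : ∑ l, b l = N + 1 := by
          rw [← ha, ← Finset.add_sum_erase _ b (Finset.mem_univ i),
            ← Finset.add_sum_erase (Finset.univ.erase i) (f := b) (a := j) (h := by simp [hj]),
            ← Finset.add_sum_erase _ a (Finset.mem_univ i),
            ← Finset.add_sum_erase (Finset.univ.erase i) a (a := j) (h := by simp [hj])]
          have : ∑ l ∈ (Finset.univ.erase i).erase j, b l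
              = ∑ l ∈ (Finset.univ.erase i).erase j, a l :=
            Finset.sum_congr rfl fun l hl => by
              simp only [Finset.mem_erase] at hl
              simp [b, hl.1, hl.2.1]
          rw [this]
          simp only [b, if_true, if_neg hj]
          omega
        refine (Metric.infDist_le_dist_of_mem
          (hfacet i _ (hr b hb) (by simp [r, b]))).trans ?_
        refine (dist_pi_le_iff (by positivity)).2 fun l => ?_
        have hi' : (a i : ℝ) ≤ n := by exact_mod_cast hi
        have h0 : (0 : ℝ) ≤ a i := Nat.cast_nonneg _
        simp only [r, Real.dist_eq, ← sub_div, abs_div, abs_of_pos hN]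
        gcongr
        simp only [b]
        split_ifs with h1 h2
        · subst h1; simpa using hi'
        · subst h2; push_cast; rw [abs_le]; constructor <;> linarith
        · simp
      · refine (Metric.infDist_le_dist_of_mem (hbi ▸ hc _ (hr b hb))).trans ?_
        refine (dist_pi_le_iff (by positivity)).2 fun l => ?_
        have h1 : (a l : ℝ) ≤ b l + n := by exact_mod_cast (hab l).1
        have h2 : (b l : ℝ) ≤ a l + n := by exact_mod_cast (hab l).2
        simp only [r, Real.dist_eq, ← sub_div, abs_div, abs_of_pos hN]
        gcongr
        rw [abs_le]
        constructor <;> linarith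
    refine (Finset.sum_le_sum fun i _ => hdist i).trans_eq ?_
    rw [Finset.sum_const, Finset.card_univ, nsmul_eq_mul, mul_div_assoc]
  have hFp : F p ≤ 0 :=
    ge_of_tendsto' ((tendsto_const_div_atTop_nhds_zero_nat ((n : ℝ) * n)).comp
      (Filter.tendsto_add_atTop_nat 1)) hbound
  have hzero := (Finset.sum_eq_zero_iff_of_nonneg fun i _ => Metric.infDist_nonneg).1
    (le_antisymm hFp (Finset.sum_nonneg fun i _ => Metric.infDist_nonneg))
  exact ⟨p, hp, fun i =>
    ((hclosed i).mem_iff_infDist_zero (hBne i)).2 (hzero i (Finset.mem_univ i))⟩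


/-- **The KKM theorem** (Knaster–Kuratowski–Mazurkiewicz). If `A 1, …, A (k+1)` are
closed subsets of the standard `k`-simplex `Δ_k ⊆ ℝ^{k+1}` such that for every nonempty
`S ⊆ [k+1]` the face `Δ^S = {x ∈ Δ_k : x i = 0 for i ∉ S}` is contained in `⋃ i ∈ S, A i`,
then `⋂ i, A i ≠ ∅`. -/
theorem KKM (k : ℕ) (A : Fin (k + 1) → Set (Fin (k + 1) → ℝ))
    (hclosed : ∀ i, IsClosed (A i))
    (hsub : ∀ i, A i ⊆ stdSimplex ℝ (Fin (k + 1)))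
    (hcover : ∀ S : Finset (Fin (k + 1)), S.Nonempty →
      {x ∈ stdSimplex ℝ (Fin (k + 1)) | ∀ i ∉ S, x i = 0} ⊆ ⋃ i ∈ S, A i) :
    (⋂ i, A i).Nonempty := by
  have hAne : ∀ i, (A i).Nonempty := fun i => by
    have := hcover {i} ⟨i, Finset.mem_singleton_self i⟩ ⟨single_mem_stdSimplex ℝ i, fun j hj =>
      Pi.single_eq_of_ne (by simpa using hj) _⟩
    exact ⟨_, by simpa using this⟩
  let d : Fin (k + 1) → (Fin (k + 1) → ℝ) → ℝ := fun i x => Metric.infDist x (A i)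
  let D : (Fin (k + 1) → ℝ) → ℝ := fun x => ∑ i, d i x
  have hd : ∀ i, Continuous (d i) := fun i => Metric.continuous_infDist_pt _
  have hD : Continuous D := continuous_finsetSum _ fun i _ => hd i
  have hd0 : ∀ i x, 0 ≤ d i x := fun i x => Metric.infDist_nonneg
  have hsum : ∀ x ∈ stdSimplex ℝ (Fin (k + 1)), ∑ i, x i * D x = ∑ i, d i x := fun x hx => by
    rw [← Finset.sum_mul, hx.2, one_mul]
  obtain ⟨x, hx, hxB⟩ := exists_mem_of_facet_subset (fun i => {x | x i * D x ≤ d i x})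
    (fun i => isClosed_le ((continuous_apply i).mul hD) (hd i))
    (fun x hx => by
      by_contra! h
      simp only [Set.mem_ofPred_eq, not_le] at h
      exact (Finset.sum_lt_sum_of_nonempty Finset.univ_nonempty fun i _ => h i).ne
        (hsum x hx).symm)
    (fun i x _ hxi => by simpa [hxi] using hd0 i x)
  have heq : ∀ i, x i * D x = d i x := fun i =>
    (Finset.sum_eq_sum_iff_of_le fun i _ => hxB i).1 (hsum x hx) i (Finset.mem_univ i)
  obtain ⟨j, hj⟩ : ∃ j, x j ≠ 0 := by
    by_contra! h
    simpa [h] using hx.2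
  have hmem := hcover (Finset.univ.filter fun i => x i ≠ 0) ⟨j, by simpa using hj⟩
    ⟨hx, fun i hi => by simpa using hi⟩
  simp only [Finset.mem_filter, Finset.mem_univ, true_and, Set.mem_iUnion] at hmem
  obtain ⟨i, hi, hxi⟩ := hmem
  have hD0 : D x = 0 := by
    have := heq i
    rw [show d i x = 0 from Metric.infDist_zero_of_mem hxi] at this
    exact (mul_eq_zero.1 this).resolve_left hi
  refine ⟨x, Set.mem_iInter.2 fun i => ((hclosed i).mem_iff_infDist_zero (hAne i)).2 ?_⟩
  change d i x = 0
  rw [← heq, hD0, mul_zero]
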